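/- arXiv:0904.1950 — 2 statements merged into one kernel-verified Lean document; each statement's English description precedes it below -/
import Mathlib

section
/- Let w:ℝ^d→ℝ be a measurable function with 0 < ‖w‖_∞ < ∞ and finite-measure support, and suppose: (W2) there exist α₁, α₂ ∈ (0,1) such that mes{x ∈ ℝ^d : |w(x)| ≥ α₁·‖w‖_∞} ≥ α₂·mes(supp w); and (W3) n·mes(supp w) ≥ μ for some real μ ≥ 1 and integer n ≥ 1. Then for all 1 ≤ p < q ≤ ∞: n^{1/q}·‖w‖_q ≤ α₁^{−1}·α₂^{−1/p}·μ^{1/q − 1/p}·n^{1/p}·‖w‖_p, where ‖·‖_p denotes the Lebesgue L^p-norm on ℝ^d. -/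
open MeasureTheory ENNReal

/-- The `L^q`-norm is bounded by the essential supremum times a power of the measure of the
support. -/
theorem eLpNorm_le_eLpNorm_top_mul_measure_support {α : Type*} [MeasurableSpace α] {ν : Measure α}
    {w : α → ℝ} (hw : AEStronglyMeasurable w ν) (q : ℝ≥0∞) :
    eLpNorm w q ν ≤ eLpNorm w ⊤ ν * ν (Function.support w) ^ (1 / q).toReal := by
  have h := eLpNorm_le_eLpNorm_mul_rpow_measure_univ (μ := ν.restrict (Function.support w))
    (le_top : q ≤ ⊤) hw.restrict
  rw [eLpNorm_restrict_eq_of_support_subset subset_rfl,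
    eLpNorm_restrict_eq_of_support_subset subset_rfl] at h
  simpa using h

/-- Markov's inequality as a lower bound on the `L^p`-norm. -/
theorem ofReal_mul_measure_rpow_le_eLpNorm {α : Type*} [MeasurableSpace α] {ν : Measure α}
    {w : α → ℝ} (hw : AEStronglyMeasurable w ν) {p : ℝ≥0∞} (hp : p ≠ 0) (hp' : p ≠ ⊤) (c : ℝ) :
    ENNReal.ofReal c * ν {x | c ≤ |w x|} ^ (1 / p).toReal ≤ eLpNorm w p ν := by
  have hpos := ENNReal.toReal_pos hp hp'
  have h := mul_meas_ge_le_pow_eLpNorm' ν hp hp' hw (ENNReal.ofReal c)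
  have hset : {x | ENNReal.ofReal c ≤ ‖w x‖ₑ} = {x | c ≤ |w x|} := by
    ext x
    simp only [Set.mem_ofPred_eq]
    rw [Real.enorm_eq_ofReal_abs, ENNReal.ofReal_le_ofReal_iff (abs_nonneg _)]
  rw [hset] at h
  rw [← ENNReal.rpow_le_rpow_iff hpos, ENNReal.mul_rpow_of_nonneg _ _ hpos.le,
    ← ENNReal.rpow_mul]
  simpa [hpos.ne'] using h

/-- For `0 < m ≤ x` and `b ≤ a`, one has `x ^ b ≤ m ^ (b - a) * x ^ a`. -/
theorem rpow_le_rpow_sub_mul_rpow {m x a b : ℝ} (hm : 0 < m) (hmx : m ≤ x) (hab : b ≤ a) :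
    x ^ b ≤ m ^ (b - a) * x ^ a := by
  have hx := hm.trans_le hmx
  calc x ^ b = x ^ (b - a) * x ^ a := by rw [← Real.rpow_add hx, sub_add_cancel]
    _ ≤ m ^ (b - a) * x ^ a := by
      gcongr ?_ * _
      exact Real.rpow_le_rpow_of_nonpos hm hmx (by linarith)

/-- **Lemma: comparison of `L_p`-norms for functions with a regular support
(Assumptions (W2)–(W3)).** For `1 ≤ p < q ≤ ∞`,
`n^{1/q} ‖w‖_q ≤ α₁⁻¹ α₂^{-1/p} μ^{1/q-1/p} n^{1/p} ‖w‖_p`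
(with `n^{1/∞} = μ^{1/∞} = 1` and `‖w‖_∞` the essential supremum). -/
theorem statement16 (d : ℕ) (hd : 0 < d)
    (w : (Fin d → ℝ) → ℝ) (hw : Measurable w)
    (hne : eLpNorm w ⊤ volume ≠ 0) (hfin : eLpNorm w ⊤ volume ≠ ⊤)
    (hsupp : volume (Function.support w) < ⊤)
    -- (W2)
    (α₁ α₂ : ℝ) (hα₁ : α₁ ∈ Set.Ioo (0 : ℝ) 1) (hα₂ : α₂ ∈ Set.Ioo (0 : ℝ) 1)
    (hW2 : ENNReal.ofReal α₂ * volume (Function.support w)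
        ≤ volume {x | α₁ * (eLpNorm w ⊤ volume).toReal ≤ |w x|})
    -- (W3)
    (μ : ℝ) (hμ : 1 ≤ μ) (n : ℕ) (hn : 1 ≤ n)
    (hW3 : ENNReal.ofReal μ ≤ (n : ℝ≥0∞) * volume (Function.support w))
    (p q : ℝ≥0∞) (hp : 1 ≤ p) (hpq : p < q) :
    (n : ℝ≥0∞) ^ (1 / q).toReal * eLpNorm w q volume
      ≤ ENNReal.ofReal (α₁⁻¹ * α₂ ^ (-(1 / p).toReal) *
            μ ^ ((1 / q).toReal - (1 / p).toReal)) *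
          ((n : ℝ≥0∞) ^ (1 / p).toReal * eLpNorm w p volume) := by
  obtain ⟨hα₁0, -⟩ := hα₁
  obtain ⟨hα₂0, -⟩ := hα₂
  have hμ0 : 0 < μ := by linarith
  have hp0 : p ≠ 0 := (zero_lt_one.trans_le hp).ne'
  have upper := eLpNorm_le_eLpNorm_top_mul_measure_support
    (ν := volume) hw.aestronglyMeasurable q
  have lower := ofReal_mul_measure_rpow_le_eLpNorm (ν := volume) hw.aestronglyMeasurable
    hp0 hpq.ne_top (α₁ * (eLpNorm w ⊤ volume).toReal)
  have hab : (1 / q).toReal ≤ (1 / p).toReal := by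
    apply ENNReal.toReal_mono (by simpa using hp0)
    gcongr
  set a := (1 / p).toReal
  set b := (1 / q).toReal
  have ha : 0 ≤ a := ENNReal.toReal_nonneg
  have hb : 0 ≤ b := ENNReal.toReal_nonneg
  lift eLpNorm w ⊤ volume to NNReal using hfin with M
  have hV := ENNReal.ofReal_toReal hsupp.ne
  set v := (volume (Function.support w)).toReal
  have hv : 0 ≤ v := ENNReal.toReal_nonneg
  have hn0 : (0 : ℝ) ≤ n := n.cast_nonneg
  rw [← hV] at upper hW2 hW3
  rw [← ENNReal.ofReal_natCast, ← ENNReal.ofReal_mul hn0,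
    ENNReal.ofReal_le_ofReal_iff (by positivity)] at hW3
  have key : (n : ℝ) ^ b * (M * v ^ b) ≤ (α₁⁻¹ * α₂ ^ (-a) * μ ^ (b - a)) *
      ((n : ℝ) ^ a * (α₁ * M * (α₂ * v) ^ a)) := by
    have h := rpow_le_rpow_sub_mul_rpow hμ0 hW3 hab
    rw [Real.mul_rpow hn0 hv, Real.mul_rpow hn0 hv] at h
    rw [Real.mul_rpow hα₂0.le hv, Real.rpow_neg hα₂0.le]
    have hα₂a : α₂ ^ a ≠ 0 := (Real.rpow_pos_of_pos hα₂0 a).ne'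
    calc (n : ℝ) ^ b * (M * v ^ b) = M * ((n : ℝ) ^ b * v ^ b) := by ring
      _ ≤ M * (μ ^ (b - a) * ((n : ℝ) ^ a * v ^ a)) := by gcongr
      _ = _ := by field_simp
  rw [← ENNReal.ofReal_natCast, ENNReal.ofReal_rpow_of_nonneg hn0 hb,
    ENNReal.ofReal_rpow_of_nonneg hn0 ha]
  calc ENNReal.ofReal ((n : ℝ) ^ b) * eLpNorm w q volume
      ≤ ENNReal.ofReal ((n : ℝ) ^ b) * (M * ENNReal.ofReal v ^ b) := by gcongr
    _ = ENNReal.ofReal ((n : ℝ) ^ b * (M * v ^ b)) := by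
      rw [ENNReal.ofReal_rpow_of_nonneg hv hb, ENNReal.ofReal_mul (by positivity),
        ENNReal.ofReal_mul M.coe_nonneg, ENNReal.ofReal_coe_nnreal]
    _ ≤ _ := ENNReal.ofReal_le_ofReal key
    _ = ENNReal.ofReal (α₁⁻¹ * α₂ ^ (-a) * μ ^ (b - a)) * (ENNReal.ofReal ((n : ℝ) ^ a) *
          (ENNReal.ofReal (α₁ * M) * (ENNReal.ofReal α₂ * ENNReal.ofReal v) ^ a)) := by
      rw [← ENNReal.ofReal_mul hα₂0.le, ENNReal.ofReal_rpow_of_nonneg (by positivity) ha,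
        ← ENNReal.ofReal_mul (by positivity), ← ENNReal.ofReal_mul (by positivity),
        ← ENNReal.ofReal_mul (by positivity)]
    _ ≤ _ := by
      gcongr
      refine le_trans ?_ lower
      gcongr
      simp
end

section
/- Let K, K', Q, Q' satisfy Assumptions (K1)–(K2), let h, h', 𝔥, 𝔥' ∈ (0,1]^d, and let n ≥ 1. Then for every p ∈ [1,∞]: (1) ‖n^{−1}·K_h‖_p = n^{−1}·V_h^{−1+1/p}·‖K‖_p; (2) ‖n^{−1}K_h − n^{−1}K'_{h'}‖_p ≤ n^{−1}·(V_{h∨h'})^{−1+1/p}·D( d₁(K,h;K',h') ); and (3) ‖n^{−1}(K_h * Q_𝔥) − n^{−1}(K'_{h'} * Q'_{𝔥'})‖_p ≤ 2·n^{−1}·k_∞·[ V_{h∨h'} ∨ V_{𝔥∨𝔥'} ]^{−1+1/p}·D( 2·d₂ ), where d₂ := max( ‖K−K'‖_∞ ∨ ‖Q−Q'‖_∞, Δ_ℋ(h,h') ∨ Δ_ℋ(𝔥,𝔥') ). -/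
open MeasureTheory ENNReal

/-- `V_h = ∏ᵢ hᵢ`. -/
noncomputable def Vh {d : ℕ} (h : Fin d → ℝ) : ℝ := ∏ i, h i

/-- The rescaled kernel `K_h(x) = V_h⁻¹ K(x/h)` (coordinate-wise division). -/
noncomputable def scaleKer {d : ℕ} (K : (Fin d → ℝ) → ℝ) (h : Fin d → ℝ)
    (x : Fin d → ℝ) : ℝ :=
  (Vh h)⁻¹ * K fun i => x i / h i

/-- The distance `Δ_ℋ(h,h') = maxᵢ ln((hᵢ∨hᵢ')/(hᵢ∧hᵢ'))` on bandwidths. -/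
noncomputable def DeltaH {d : ℕ} (h h' : Fin d → ℝ) : ℝ :=
  ⨆ i, Real.log (max (h i) (h' i) / min (h i) (h' i))

/-- `D(x) = e^{dx}[x + (1/2) L √d (e^x - 1) + k_∞ (e^{dx} - 1)]`. -/
noncomputable def Dfun (d : ℕ) (L kinf x : ℝ) : ℝ :=
  Real.exp (d * x) *
    (x + 1 / 2 * L * Real.sqrt d * (Real.exp x - 1) + kinf * (Real.exp (d * x) - 1))

/-- Convolution on `ℝ^d`. -/
noncomputable def convol {d : ℕ} (K Q : (Fin d → ℝ) → ℝ) (x : Fin d → ℝ) : ℝ :=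
  ∫ y, K (x - y) * Q y

/-- The sup-distance `‖K - K'‖_∞` between two kernels. -/
noncomputable def supDist {d : ℕ} (K K' : (Fin d → ℝ) → ℝ) : ℝ :=
  ⨆ x, |K x - K' x|

/-- Assumptions (K1)–(K2) on a kernel: Lipschitz with constant `L` for the Euclidean
distance, supported in `[-1/2,1/2]^d`, `k₁ ≤ |∫K| ≤ ‖K‖_∞ ≤ k_∞`. -/
def AssumpK {d : ℕ} (L k1 kinf : ℝ) (K : (Fin d → ℝ) → ℝ) : Prop :=
  (∀ x y, |K x - K y| ≤ L * Real.sqrt (∑ i, (x i - y i) ^ 2)) ∧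
  (Function.support K ⊆ Set.Icc (fun _ => -(1 / 2)) fun _ => (1 / 2)) ∧
  (k1 ≤ |∫ t, K t|) ∧ (∀ x, |K x| ≤ kinf)

section BoundedFunctions

variable {α : Type*} [MeasurableSpace α] {μ : Measure α}

/-- A function bounded by `C / W` with `L¹`-norm at most `C` has `L^p`-norm at most
`C * W ^ (-1 + 1 / p)`. -/
lemma eLpNorm_le_of_lintegral_le_of_bound {F : α → ℝ} {C W c : ℝ} (hC : 0 ≤ C) (hW : 0 < W)
    (hc : 0 ≤ c) (h1 : ∫⁻ x, ‖F x‖ₑ ∂μ ≤ ENNReal.ofReal C) (hsup : ∀ x, |F x| ≤ C * W⁻¹)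
    {p : ℝ≥0∞} (hp : 1 ≤ p) :
    eLpNorm (fun x => c * F x) p μ
      ≤ ENNReal.ofReal (c * W ^ (-1 + (1 / p).toReal) * C) := by
  have hF : eLpNorm F p μ ≤ ENNReal.ofReal (W ^ (-1 + (1 / p).toReal) * C) := by
    by_cases hpt : p = ∞
    · subst hpt
      rw [eLpNorm_exponent_top]
      refine eLpNormEssSup_le_of_ae_bound (Filter.Eventually.of_forall fun x => ?_)
      simpa [Real.rpow_neg_one, mul_comm] using hsup x
    · have hp0 : p ≠ 0 := (lt_of_lt_of_le one_pos hp).ne'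
      have hr : 1 ≤ p.toReal := by
        simpa using ENNReal.toReal_mono hpt hp
      have hr0 : 0 < p.toReal := by linarith
      rw [eLpNorm_eq_lintegral_rpow_enorm_toReal hp0 hpt]
      have hpt' : ∀ x, ‖F x‖ₑ ^ p.toReal
          ≤ ENNReal.ofReal ((C * W⁻¹) ^ (p.toReal - 1)) * ‖F x‖ₑ := by
        intro x
        rw [← ofReal_norm, Real.norm_eq_abs,
          ENNReal.ofReal_rpow_of_nonneg (abs_nonneg _) hr0.le, ← ENNReal.ofReal_mul (by positivity)]
        refine ENNReal.ofReal_le_ofReal ?_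
        calc |F x| ^ p.toReal = |F x| ^ ((p.toReal - 1) + 1) := by ring_nf
          _ = |F x| ^ (p.toReal - 1) * |F x| ^ (1 : ℝ) :=
            Real.rpow_add_of_nonneg (abs_nonneg _) (by linarith) zero_le_one
          _ ≤ (C * W⁻¹) ^ (p.toReal - 1) * |F x| := by
            rw [Real.rpow_one]
            exact mul_le_mul_of_nonneg_right
              (Real.rpow_le_rpow (abs_nonneg _) (hsup x) (by linarith)) (abs_nonneg _)
      calc (∫⁻ x, ‖F x‖ₑ ^ p.toReal ∂μ) ^ (1 / p.toReal)
          ≤ (ENNReal.ofReal ((C * W⁻¹) ^ (p.toReal - 1)) * ENNReal.ofReal C)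
              ^ (1 / p.toReal) := by
            refine ENNReal.rpow_le_rpow ?_ (by positivity)
            refine (lintegral_mono hpt').trans ?_
            rw [lintegral_const_mul' _ _ ENNReal.ofReal_ne_top]
            gcongr
        _ = ENNReal.ofReal (((C * W⁻¹) ^ (p.toReal - 1) * C) ^ (1 / p.toReal)) := by
            rw [← ENNReal.ofReal_mul (by positivity),
              ENNReal.ofReal_rpow_of_nonneg (by positivity) (by positivity)]
        _ = ENNReal.ofReal (W ^ (-1 + (1 / p).toReal) * C) := by
            congr 1
            have e1 : (C * W⁻¹) ^ (p.toReal - 1) * C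
                = (W ^ (-1 + (1 / p).toReal) * C) ^ p.toReal := by
              rw [Real.mul_rpow hC (by positivity), Real.mul_rpow (by positivity) hC,
                ← Real.rpow_mul hW.le, Real.inv_rpow hW.le, ← Real.rpow_neg hW.le]
              have e2 : C ^ p.toReal = C ^ (p.toReal - 1) * C := by
                calc C ^ p.toReal = C ^ ((p.toReal - 1) + 1) := by ring_nf
                  _ = _ := by
                    rw [Real.rpow_add_of_nonneg hC (by linarith) zero_le_one, Real.rpow_one]
              have e3 : (-1 + (1 / p).toReal) * p.toReal = -(p.toReal - 1) := by
                rw [ENNReal.toReal_div, ENNReal.toReal_one]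
                field_simp
                ring
              rw [e2, e3]
              ring
            rw [e1, ← Real.rpow_mul (by positivity), mul_one_div_cancel hr0.ne', Real.rpow_one]
  have := eLpNorm_const_smul c F p μ
  simp only [Pi.smul_def, smul_eq_mul] at this
  rw [this, ← ofReal_norm, Real.norm_of_nonneg hc, mul_assoc,
    ENNReal.ofReal_mul hc]
  gcongr

end BoundedFunctions

section Kernels

variable {d : ℕ} {L k1 kinf : ℝ} {K K' : (Fin d → ℝ) → ℝ} {h h' : Fin d → ℝ}

lemma Vh_pos (hh : ∀ i, 0 < h i) : 0 < Vh h := Finset.prod_pos fun i _ => hh i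

lemma Vh_le_exp_mul {δ : ℝ} (hh : ∀ i, 0 < h i) (hle : ∀ i, h i ≤ Real.exp δ * h' i) :
    Vh h ≤ Real.exp (d * δ) * Vh h' := by
  calc Vh h ≤ ∏ i, Real.exp δ * h' i :=
        Finset.prod_le_prod (fun i _ => (hh i).le) fun i _ => hle i
    _ = _ := by
      rw [Finset.prod_mul_distrib, Finset.prod_const, Finset.card_univ, Fintype.card_fin,
        Real.exp_nat_mul, Vh]

/-- A function supported in a box of volume `V_h` and bounded by `M / V_h` has `L¹`-norm at
most `M`. -/
lemma lintegral_enorm_le_of_box (hh : ∀ i, 0 < h i) {f : (Fin d → ℝ) → ℝ} {M : ℝ} (hM0 : 0 ≤ M)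
    (hs : ∀ x, f x ≠ 0 → ∀ i, |x i| ≤ h i / 2) (hM : ∀ x, |f x| ≤ M * (Vh h)⁻¹) :
    ∫⁻ x, ‖f x‖ₑ ≤ ENNReal.ofReal M := by
  have hV := Vh_pos hh
  have hsub : (fun x => ‖f x‖ₑ).support ⊆ Set.Icc (fun i => -(h i / 2)) (fun i => h i / 2) := by
    intro x hx
    have hx' : f x ≠ 0 := by simpa using hx
    exact ⟨fun i => (abs_le.1 (hs x hx' i)).1, fun i => (abs_le.1 (hs x hx' i)).2⟩
  rw [← setLIntegral_eq_of_support_subset hsub]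
  calc _ ≤ ∫⁻ _ in Set.Icc (fun i => -(h i / 2)) (fun i => h i / 2),
          ENNReal.ofReal (M * (Vh h)⁻¹) := by
        refine lintegral_mono fun x => ?_
        rw [← ofReal_norm]
        exact ENNReal.ofReal_le_ofReal (hM x)
    _ = ENNReal.ofReal M := by
        rw [setLIntegral_const, Real.volume_Icc_pi]
        simp only [sub_neg_eq_add, add_halves]
        rw [← ENNReal.ofReal_prod_of_nonneg fun i _ => (hh i).le,
          ← ENNReal.ofReal_mul (by positivity)]
        congr 1
        change M * (Vh h)⁻¹ * Vh h = M
        field_simp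

lemma AssumpK.abs_le_half (hK : AssumpK L k1 kinf K) {x : Fin d → ℝ} (hx : K x ≠ 0) (i : Fin d) :
    |x i| ≤ 1 / 2 :=
  abs_le.2 ⟨(hK.2.1 hx).1 i, (hK.2.1 hx).2 i⟩

lemma AssumpK.continuous (hK : AssumpK L k1 kinf K) : Continuous K := by
  refine continuous_iff_continuousAt.2 fun a => ?_
  rw [ContinuousAt, tendsto_iff_dist_tendsto_zero]
  have hlim : Filter.Tendsto (fun x : Fin d → ℝ => L * Real.sqrt (∑ i, (x i - a i) ^ 2))
      (nhds a) (nhds 0) := by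
    have : Continuous fun x : Fin d → ℝ => L * Real.sqrt (∑ i, (x i - a i) ^ 2) := by fun_prop
    simpa using this.tendsto a
  exact squeeze_zero (fun _ => dist_nonneg) (fun x => hK.1 x a) hlim

lemma continuous_scaleKer (hK : Continuous K) : Continuous (scaleKer K h) := by
  unfold scaleKer
  fun_prop

lemma scaleKer_support (hh : ∀ i, 0 < h i) (hK : AssumpK L k1 kinf K) {x : Fin d → ℝ}
    (hx : scaleKer K h x ≠ 0) (i : Fin d) : |x i| ≤ h i / 2 := by
  have := hK.abs_le_half (right_ne_zero_of_mul hx) i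
  rw [abs_div, abs_of_pos (hh i), div_le_iff₀ (hh i)] at this
  linarith

lemma abs_scaleKer_le (hh : ∀ i, 0 < h i) (hK : AssumpK L k1 kinf K) (x : Fin d → ℝ) :
    |scaleKer K h x| ≤ kinf * (Vh h)⁻¹ := by
  have hV := Vh_pos hh
  rw [scaleKer, abs_mul, abs_of_pos (inv_pos.2 hV), mul_comm]
  exact mul_le_mul_of_nonneg_right (hK.2.2.2 _) (inv_pos.2 hV).le

lemma lintegral_scaleKer_le (hh : ∀ i, 0 < h i) (hk : 0 ≤ kinf) (hK : AssumpK L k1 kinf K) :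
    ∫⁻ x, ‖scaleKer K h x‖ₑ ≤ ENNReal.ofReal kinf :=
  lintegral_enorm_le_of_box hh hk (fun _ hx => scaleKer_support hh hK hx) (abs_scaleKer_le hh hK)

/-- Two coordinatewise rescalings of a point lying in the first box are close when the
bandwidths are. -/
lemma abs_div_sub_div_le {a b t δ : ℝ} (ha : 0 < a) (hb : 0 < b)
    (hab : a ≤ Real.exp δ * b) (hba : b ≤ Real.exp δ * a) (ht : |t / a| ≤ 1 / 2) :
    |t / a - t / b| ≤ 1 / 2 * (Real.exp δ - 1) := by
  have e : t / a - t / b = t / a * (1 - a / b) := by field_simp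
  rw [e, abs_mul]
  have h1 : a / b ≤ Real.exp δ := by rwa [div_le_iff₀ hb]
  have h2 : b / a ≤ Real.exp δ := by rwa [div_le_iff₀ ha]
  have h3 : 2 ≤ a / b + b / a := by
    rw [div_add_div _ _ hb.ne' ha.ne', le_div_iff₀ (by positivity)]
    nlinarith [sq_nonneg (a - b)]
  have : |1 - a / b| ≤ Real.exp δ - 1 := abs_le.2 ⟨by linarith, by linarith⟩
  exact mul_le_mul ht this (abs_nonneg _) (by norm_num)

lemma abs_kernel_sub_le_of_box (hL : 0 < L) (hK : AssumpK L k1 kinf K) {δ : ℝ} (hδ : 0 ≤ δ)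
    (hh : ∀ i, 0 < h i) (hh' : ∀ i, 0 < h' i) (h1 : ∀ i, h i ≤ Real.exp δ * h' i)
    (h2 : ∀ i, h' i ≤ Real.exp δ * h i) (x : Fin d → ℝ) (hx : ∀ i, |x i / h i| ≤ 1 / 2) :
    |K (fun i => x i / h i) - K (fun i => x i / h' i)|
      ≤ 1 / 2 * L * Real.sqrt d * (Real.exp δ - 1) := by
  have hE : 0 ≤ Real.exp δ - 1 := by linarith [Real.one_le_exp hδ]
  refine (hK.1 _ _).trans ?_
  have hsum : ∑ i, (x i / h i - x i / h' i) ^ 2 ≤ d * (1 / 2 * (Real.exp δ - 1)) ^ 2 := by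
    calc _ ≤ ∑ _i : Fin d, (1 / 2 * (Real.exp δ - 1)) ^ 2 :=
          Finset.sum_le_sum fun i _ => sq_le_sq.2 <| by
            rw [abs_of_nonneg (a := 1 / 2 * (Real.exp δ - 1)) (by positivity)]
            exact abs_div_sub_div_le (hh i) (hh' i) (h1 i) (h2 i) (hx i)
      _ = _ := by simp
  calc L * Real.sqrt (∑ i, (x i / h i - x i / h' i) ^ 2)
      ≤ L * Real.sqrt (d * (1 / 2 * (Real.exp δ - 1)) ^ 2) := by gcongr
    _ = _ := by
      rw [Real.sqrt_mul (by positivity), Real.sqrt_sq (by positivity)]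
      ring

lemma abs_kernel_sub_le (hL : 0 < L) (hK : AssumpK L k1 kinf K) {δ : ℝ} (hδ : 0 ≤ δ)
    (hh : ∀ i, 0 < h i) (hh' : ∀ i, 0 < h' i) (h1 : ∀ i, h i ≤ Real.exp δ * h' i)
    (h2 : ∀ i, h' i ≤ Real.exp δ * h i) (x : Fin d → ℝ) :
    |K (fun i => x i / h i) - K (fun i => x i / h' i)|
      ≤ 1 / 2 * L * Real.sqrt d * (Real.exp δ - 1) := by
  by_cases hx : K (fun i => x i / h i) = 0
  · by_cases hx' : K (fun i => x i / h' i) = 0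
    · have hE : 0 ≤ Real.exp δ - 1 := by linarith [Real.one_le_exp hδ]
      rw [hx, hx', sub_zero, abs_zero]
      positivity
    · rw [abs_sub_comm]
      exact abs_kernel_sub_le_of_box hL hK hδ hh' hh h2 h1 x fun i => hK.abs_le_half hx' i
  · exact abs_kernel_sub_le_of_box hL hK hδ hh hh' h1 h2 x fun i => hK.abs_le_half hx i

lemma Dfun_nonneg (hL : 0 ≤ L) (hk : 0 ≤ kinf) {δ : ℝ} (hδ : 0 ≤ δ) : 0 ≤ Dfun d L kinf δ := by
  have hE : 0 ≤ Real.exp δ - 1 := by linarith [Real.one_le_exp hδ]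
  have hE' : 0 ≤ Real.exp (d * δ) - 1 := by
    linarith [Real.one_le_exp (mul_nonneg d.cast_nonneg hδ)]
  unfold Dfun
  positivity

lemma exp_mul_Dfun_le (hL : 0 ≤ L) (hk : 0 ≤ kinf) {δ : ℝ} (hδ : 0 ≤ δ) :
    Real.exp (d * δ) * Dfun d L kinf δ ≤ Dfun d L kinf (2 * δ) := by
  have hle : δ ≤ 2 * δ := by linarith
  have hE : 0 ≤ Real.exp δ - 1 := by linarith [Real.one_le_exp hδ]
  have hE' : 0 ≤ Real.exp (d * δ) - 1 := by
    linarith [Real.one_le_exp (mul_nonneg d.cast_nonneg hδ)]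
  have e : Real.exp (d * (2 * δ)) = Real.exp (d * δ) * Real.exp (d * δ) := by
    rw [← Real.exp_add]
    ring_nf
  calc Real.exp (d * δ) * Dfun d L kinf δ
      = Real.exp (d * (2 * δ)) * (δ + 1 / 2 * L * Real.sqrt d * (Real.exp δ - 1)
          + kinf * (Real.exp (d * δ) - 1)) := by
        rw [e, Dfun]
        ring
    _ ≤ Dfun d L kinf (2 * δ) := by
        unfold Dfun
        gcongr

lemma Dfun_le_two_mul (hL : 0 ≤ L) (hk : 0 ≤ kinf) {δ : ℝ} (hδ : 0 ≤ δ) :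
    Dfun d L kinf δ ≤ Dfun d L kinf (2 * δ) :=
  (le_mul_of_one_le_left (Dfun_nonneg hL hk hδ)
    (Real.one_le_exp (mul_nonneg d.cast_nonneg hδ))).trans (exp_mul_Dfun_le hL hk hδ)

lemma Vh_max_le_left {δ : ℝ} (hδ : 0 ≤ δ) (hh : ∀ i, 0 < h i)
    (h2 : ∀ i, h' i ≤ Real.exp δ * h i) :
    Vh (fun i => max (h i) (h' i)) ≤ Real.exp (d * δ) * Vh h :=
  Vh_le_exp_mul (fun i => lt_max_of_lt_left (hh i)) fun i =>
    max_le (le_mul_of_one_le_left (hh i).le (Real.one_le_exp hδ)) (h2 i)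

lemma Vh_max_le_right {δ : ℝ} (hδ : 0 ≤ δ) (hh' : ∀ i, 0 < h' i)
    (h1 : ∀ i, h i ≤ Real.exp δ * h' i) :
    Vh (fun i => max (h i) (h' i)) ≤ Real.exp (d * δ) * Vh h' := by
  simpa only [max_comm] using Vh_max_le_left hδ hh' h1

lemma le_Vh_max_left (hh : ∀ i, 0 < h i) : Vh h ≤ Vh (fun i => max (h i) (h' i)) :=
  Finset.prod_le_prod (fun i _ => (hh i).le) fun _ _ => le_max_left _ _

lemma le_Vh_max_right (hh' : ∀ i, 0 < h' i) : Vh h' ≤ Vh (fun i => max (h i) (h' i)) :=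
  Finset.prod_le_prod (fun i _ => (hh' i).le) fun _ _ => le_max_right _ _

lemma abs_scaleKer_sub_le (hL : 0 < L) (hk : 0 ≤ kinf) (hK' : AssumpK L k1 kinf K')
    {δ : ℝ} (hδ : 0 ≤ δ) (hKK : ∀ x, |K x - K' x| ≤ δ)
    (hh : ∀ i, 0 < h i) (hh' : ∀ i, 0 < h' i) (h1 : ∀ i, h i ≤ Real.exp δ * h' i)
    (h2 : ∀ i, h' i ≤ Real.exp δ * h i) (x : Fin d → ℝ) :
    |scaleKer K h x - scaleKer K' h' x|
      ≤ Dfun d L kinf δ * (Vh fun i => max (h i) (h' i))⁻¹ := by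
  set W := Vh fun i => max (h i) (h' i) with hW
  have hV := Vh_pos hh
  have hV' := Vh_pos hh'
  have hWpos : 0 < W := Vh_pos fun i => lt_max_of_lt_left (hh i)
  have ha1 : W / Vh h ≤ Real.exp (d * δ) := by
    rw [div_le_iff₀ hV]
    exact Vh_max_le_left hδ hh h2
  have hb1 : W / Vh h' ≤ Real.exp (d * δ) := by
    rw [div_le_iff₀ hV']
    exact Vh_max_le_right hδ hh' h1
  have ha2 : 1 ≤ W / Vh h := (one_le_div hV).2 (le_Vh_max_left hh)
  have hb2 : 1 ≤ W / Vh h' := (one_le_div hV').2 (le_Vh_max_right hh')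
  have hE : 0 ≤ Real.exp δ - 1 := by linarith [Real.one_le_exp hδ]
  have hE' : 1 ≤ Real.exp (d * δ) := Real.one_le_exp (mul_nonneg d.cast_nonneg hδ)
  rw [← div_eq_mul_inv, le_div_iff₀ hWpos]
  have e : (scaleKer K h x - scaleKer K' h' x) * W
      = W / Vh h * (K (fun i => x i / h i) - K' (fun i => x i / h i))
        + W / Vh h * (K' (fun i => x i / h i) - K' (fun i => x i / h' i))
        + (W / Vh h - W / Vh h') * K' (fun i => x i / h' i) := by
    unfold scaleKer
    ring
  have hab : |W / Vh h - W / Vh h'| ≤ Real.exp (d * δ) - 1 :=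
    abs_le.2 ⟨by linarith, by linarith⟩
  rw [← abs_of_pos hWpos, ← abs_mul, e]
  refine (abs_add_three _ _ _).trans ?_
  rw [abs_mul, abs_mul, abs_mul, abs_of_pos (by positivity : 0 < W / Vh h)]
  have t1 : W / Vh h * |K (fun i => x i / h i) - K' (fun i => x i / h i)|
      ≤ Real.exp (d * δ) * δ := by
    gcongr
    exact hKK _
  have t2 : W / Vh h * |K' (fun i => x i / h i) - K' (fun i => x i / h' i)|
      ≤ Real.exp (d * δ) * (1 / 2 * L * Real.sqrt d * (Real.exp δ - 1)) := by
    gcongr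
    exact abs_kernel_sub_le hL hK' hδ hh hh' h1 h2 x
  have t3 : |W / Vh h - W / Vh h'| * |K' (fun i => x i / h' i)|
      ≤ Real.exp (d * δ) * (kinf * (Real.exp (d * δ) - 1)) := by
    calc _ ≤ (Real.exp (d * δ) - 1) * kinf :=
          mul_le_mul hab (hK'.2.2.2 _) (abs_nonneg _) (by linarith)
      _ = 1 * (kinf * (Real.exp (d * δ) - 1)) := by ring
      _ ≤ _ := mul_le_mul_of_nonneg_right hE' (mul_nonneg hk (by linarith))
  unfold Dfun
  linarith

lemma lintegral_scaleKer_sub_le (hL : 0 < L) (hk : 0 ≤ kinf) (hK : AssumpK L k1 kinf K)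
    (hK' : AssumpK L k1 kinf K') {δ : ℝ} (hδ : 0 ≤ δ) (hKK : ∀ x, |K x - K' x| ≤ δ)
    (hh : ∀ i, 0 < h i) (hh' : ∀ i, 0 < h' i) (h1 : ∀ i, h i ≤ Real.exp δ * h' i)
    (h2 : ∀ i, h' i ≤ Real.exp δ * h i) :
    ∫⁻ x, ‖scaleKer K h x - scaleKer K' h' x‖ₑ ≤ ENNReal.ofReal (Dfun d L kinf δ) := by
  refine lintegral_enorm_le_of_box (h := fun i => max (h i) (h' i))
    (fun i => lt_max_of_lt_left (hh i)) (Dfun_nonneg hL.le hk hδ) (fun x hx i => ?_)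
    (abs_scaleKer_sub_le hL hk hK' hδ hKK hh hh' h1 h2)
  by_cases hx1 : scaleKer K h x = 0
  · have hx2 : scaleKer K' h' x ≠ 0 := fun h0 => hx (by rw [hx1, h0, sub_zero])
    have := scaleKer_support hh' hK' hx2 i
    have := le_max_right (h i) (h' i)
    linarith
  · have := scaleKer_support hh hK hx1 i
    have := le_max_left (h i) (h' i)
    linarith

lemma eLpNorm_scaleKer (hh : ∀ i, 0 < h i) (hK : Continuous K) {c : ℝ} (hc : 0 ≤ c)
    (p : ℝ≥0∞) :
    eLpNorm (fun x => c * scaleKer K h x) p volume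
      = ENNReal.ofReal (c * Vh h ^ (-1 + (1 / p).toReal)) * eLpNorm K p volume := by
  have hV := Vh_pos hh
  have hdet : (Matrix.diagonal fun i => (h i)⁻¹).det = (Vh h)⁻¹ := by
    rw [Matrix.det_diagonal, Finset.prod_inv_distrib, Vh]
  have hmap := Real.map_matrix_volume_pi_eq_smul_volume_pi
    (M := Matrix.diagonal fun i => (h i)⁻¹) (by rw [hdet]; positivity)
  rw [hdet, inv_inv, abs_of_pos hV] at hmap
  have hcont : Continuous (Matrix.toLin' (Matrix.diagonal fun i => (h i)⁻¹)) :=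
    LinearMap.continuous_of_finiteDimensional _
  have hcomp : (fun x => c * scaleKer K h x)
      = (c * (Vh h)⁻¹) • (K ∘ Matrix.toLin' (Matrix.diagonal fun i => (h i)⁻¹)) := by
    ext x
    have : (Matrix.toLin' (Matrix.diagonal fun i => (h i)⁻¹)) x = fun i => x i / h i := by
      ext i
      simp [Matrix.mulVec_diagonal, div_eq_inv_mul]
    simp [scaleKer, this, mul_assoc]
  rw [hcomp, eLpNorm_const_smul, ← eLpNorm_map_measure (hK.aestronglyMeasurable)
    hcont.aemeasurable, hmap, eLpNorm_smul_measure_of_ne_zero (by simpa using hV), smul_eq_mul,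
    ← mul_assoc]
  congr 1
  rw [← ofReal_norm, Real.norm_of_nonneg (by positivity),
    ENNReal.ofReal_rpow_of_pos hV, ← ENNReal.ofReal_mul (by positivity), Real.rpow_add hV,
    Real.rpow_neg_one, mul_assoc]

end Kernels

section Convolution

variable {d : ℕ} {f f' g g' : (Fin d → ℝ) → ℝ}

lemma lintegral_lintegral_enorm_mul (hf : Continuous f) (hg : Continuous g) :
    ∫⁻ x, ∫⁻ y, ‖f (x - y)‖ₑ * ‖g y‖ₑ = (∫⁻ x, ‖f x‖ₑ) * ∫⁻ y, ‖g y‖ₑ := by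
  rw [lintegral_lintegral_swap (Measurable.aemeasurable (by fun_prop))]
  calc _ = ∫⁻ y, (∫⁻ x, ‖f x‖ₑ) * ‖g y‖ₑ := by
        refine lintegral_congr fun y => ?_
        rw [lintegral_mul_const' _ _ enorm_ne_top,
          lintegral_sub_right_eq_self (fun x => ‖f x‖ₑ) y]
    _ = _ := lintegral_const_mul _ (by fun_prop)

lemma lintegral_enorm_mul_le_left {x : Fin d → ℝ} {A B : ℝ} (hA : 0 ≤ A)
    (hfA : ∀ z, |f z| ≤ A) (hg : ∫⁻ y, ‖g y‖ₑ ≤ ENNReal.ofReal B) :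
    ∫⁻ y, ‖f (x - y)‖ₑ * ‖g y‖ₑ ≤ ENNReal.ofReal (A * B) := by
  calc _ ≤ ∫⁻ y, ENNReal.ofReal A * ‖g y‖ₑ := by
        refine lintegral_mono fun y => ?_
        rw [← ofReal_norm (f (x - y))]
        gcongr
        exact hfA _
    _ ≤ ENNReal.ofReal (A * B) := by
        rw [lintegral_const_mul' _ _ ENNReal.ofReal_ne_top, ENNReal.ofReal_mul hA]
        gcongr

lemma lintegral_enorm_mul_le_right {x : Fin d → ℝ} {A B : ℝ} (hA : 0 ≤ A)
    (hf : ∫⁻ y, ‖f y‖ₑ ≤ ENNReal.ofReal A) (hgB : ∀ z, |g z| ≤ B) :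
    ∫⁻ y, ‖f (x - y)‖ₑ * ‖g y‖ₑ ≤ ENNReal.ofReal (A * B) := by
  calc _ ≤ ∫⁻ y, ‖f (x - y)‖ₑ * ENNReal.ofReal B := by
        refine lintegral_mono fun y => ?_
        rw [← ofReal_norm (g y)]
        gcongr
        exact hgB _
    _ ≤ ENNReal.ofReal (A * B) := by
        rw [lintegral_mul_const' _ _ ENNReal.ofReal_ne_top, ENNReal.ofReal_mul hA,
          lintegral_sub_left_eq_self (fun y => ‖f y‖ₑ) x]
        gcongr

lemma integrable_convol_integrand (hf : Continuous f) (hg : Continuous g) {A B : ℝ}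
    (hA : 0 ≤ A) (hfA : ∀ z, |f z| ≤ A) (hgB : ∫⁻ y, ‖g y‖ₑ ≤ ENNReal.ofReal B)
    (x : Fin d → ℝ) : Integrable fun y => f (x - y) * g y := by
  refine ⟨Continuous.aestronglyMeasurable (by fun_prop), ?_⟩
  rw [hasFiniteIntegral_iff_enorm]
  simp only [enorm_mul]
  exact (lintegral_enorm_mul_le_left hA hfA hgB).trans_lt ENNReal.ofReal_lt_top

lemma enorm_convol_sub_le (hf : Continuous f) (hg : Continuous g) (hf' : Continuous f')
    {x : Fin d → ℝ} (hi : Integrable fun y => f (x - y) * g y)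
    (hi' : Integrable fun y => f' (x - y) * g' y) :
    ‖convol f g x - convol f' g' x‖ₑ
      ≤ (∫⁻ y, ‖f (x - y) - f' (x - y)‖ₑ * ‖g y‖ₑ)
        + ∫⁻ y, ‖f' (x - y)‖ₑ * ‖g y - g' y‖ₑ := by
  rw [convol, convol, ← integral_sub hi hi', ← lintegral_add_left (by fun_prop)]
  refine (enorm_integral_le_lintegral_enorm _).trans (lintegral_mono fun y => ?_)
  rw [← enorm_mul, ← enorm_mul]
  refine le_trans (le_of_eq ?_) (enorm_add_le _ _)
  congr 1
  ring

end Convolution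

section Distances

variable {d : ℕ} {L k1 kinf : ℝ} {K K' : (Fin d → ℝ) → ℝ} {h h' : Fin d → ℝ}

lemma abs_sub_le_supDist (hK : AssumpK L k1 kinf K) (hK' : AssumpK L k1 kinf K')
    (x : Fin d → ℝ) : |K x - K' x| ≤ supDist K K' := by
  refine le_ciSup (f := fun x => |K x - K' x|) ⟨kinf + kinf, ?_⟩ x
  rintro _ ⟨y, rfl⟩
  exact (abs_sub _ _).trans (add_le_add (hK.2.2.2 y) (hK'.2.2.2 y))

lemma le_exp_DeltaH_mul (hh : ∀ i, 0 < h i) (hh' : ∀ i, 0 < h' i) (i : Fin d) :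
    h i ≤ Real.exp (DeltaH h h') * h' i ∧ h' i ≤ Real.exp (DeltaH h h') * h i := by
  have hmin : 0 < min (h i) (h' i) := lt_min (hh i) (hh' i)
  have hmax : 0 < max (h i) (h' i) := lt_max_of_lt_left (hh i)
  have hle : Real.log (max (h i) (h' i) / min (h i) (h' i)) ≤ DeltaH h h' :=
    le_ciSup (f := fun i => Real.log (max (h i) (h' i) / min (h i) (h' i)))
      (Set.finite_range _).bddAbove i
  rw [Real.log_le_iff_le_exp (by positivity), div_le_iff₀ hmin] at hle
  have hE := (Real.exp_pos (DeltaH h h')).le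
  exact ⟨(le_max_left _ _).trans (hle.trans (mul_le_mul_of_nonneg_left (min_le_right _ _) hE)),
    (le_max_right _ _).trans (hle.trans (mul_le_mul_of_nonneg_left (min_le_left _ _) hE))⟩

lemma le_exp_mul_of_DeltaH_le {δ : ℝ} (hh : ∀ i, 0 < h i) (hh' : ∀ i, 0 < h' i)
    (hδ : DeltaH h h' ≤ δ) :
    (∀ i, h i ≤ Real.exp δ * h' i) ∧ ∀ i, h' i ≤ Real.exp δ * h i := by
  have hE := Real.exp_le_exp.2 hδ
  exact ⟨fun i => (le_exp_DeltaH_mul hh hh' i).1.trans (mul_le_mul_of_nonneg_right hE (hh' i).le),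
    fun i => (le_exp_DeltaH_mul hh hh' i).2.trans (mul_le_mul_of_nonneg_right hE (hh i).le)⟩

lemma supDist_nonneg : 0 ≤ supDist K K' := Real.iSup_nonneg fun _ => abs_nonneg _

end Distances

section ScaledConvolution

variable {d : ℕ} {L k1 kinf : ℝ} {K K' Q Q' : (Fin d → ℝ) → ℝ} {h h' 𝓱 𝓱' : Fin d → ℝ}

lemma inv_Vh_mul_Dfun_le (hL : 0 ≤ L) (hk : 0 ≤ kinf) {δ : ℝ} (hδ : 0 ≤ δ)
    {V W : ℝ} (hV : 0 < V) (hW : 0 < W) (hVW : W ≤ Real.exp (d * δ) * V) :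
    V⁻¹ * Dfun d L kinf δ ≤ Dfun d L kinf (2 * δ) * W⁻¹ := by
  rw [← div_eq_inv_mul, ← div_eq_mul_inv, div_le_div_iff₀ hV hW]
  calc Dfun d L kinf δ * W ≤ Dfun d L kinf δ * (Real.exp (d * δ) * V) :=
        mul_le_mul_of_nonneg_left hVW (Dfun_nonneg hL hk hδ)
    _ = Real.exp (d * δ) * Dfun d L kinf δ * V := by ring
    _ ≤ _ := mul_le_mul_of_nonneg_right (exp_mul_Dfun_le hL hk hδ) hV.le

lemma eLpNorm_convol_scaleKer_sub_le (hL : 0 < L) (hk : 0 ≤ kinf)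
    (hK : AssumpK L k1 kinf K) (hK' : AssumpK L k1 kinf K')
    (hQ : AssumpK L k1 kinf Q) (hQ' : AssumpK L k1 kinf Q') {δ : ℝ} (hδ : 0 ≤ δ)
    (hKK : ∀ x, |K x - K' x| ≤ δ) (hQQ : ∀ x, |Q x - Q' x| ≤ δ)
    (hh : ∀ i, 0 < h i) (hh' : ∀ i, 0 < h' i) (h𝓱 : ∀ i, 0 < 𝓱 i) (h𝓱' : ∀ i, 0 < 𝓱' i)
    (h1 : ∀ i, h i ≤ Real.exp δ * h' i) (h2 : ∀ i, h' i ≤ Real.exp δ * h i)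
    (h3 : ∀ i, 𝓱 i ≤ Real.exp δ * 𝓱' i) (h4 : ∀ i, 𝓱' i ≤ Real.exp δ * 𝓱 i)
    {c : ℝ} (hc : 0 ≤ c) {p : ℝ≥0∞} (hp : 1 ≤ p) :
    eLpNorm (fun x => c * (convol (scaleKer K h) (scaleKer Q 𝓱) x
        - convol (scaleKer K' h') (scaleKer Q' 𝓱') x)) p volume
      ≤ ENNReal.ofReal (c * (max (Vh fun i => max (h i) (h' i))
          (Vh fun i => max (𝓱 i) (𝓱' i))) ^ (-1 + (1 / p).toReal)
            * (2 * kinf * Dfun d L kinf (2 * δ))) := by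
  have hD := Dfun_nonneg (d := d) hL.le hk hδ
  have hD2 := Dfun_nonneg (d := d) hL.le hk (by positivity : 0 ≤ 2 * δ)
  have hDD := Dfun_le_two_mul (d := d) hL.le hk hδ
  have hV1 := Vh_pos hh
  have hV1' := Vh_pos hh'
  have hV2 := Vh_pos h𝓱
  have hV2' := Vh_pos h𝓱'
  have hW1 : 0 < Vh fun i => max (h i) (h' i) := Vh_pos fun i => lt_max_of_lt_left (hh i)
  have hW2 : 0 < Vh fun i => max (𝓱 i) (𝓱' i) := Vh_pos fun i => lt_max_of_lt_left (h𝓱 i)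
  have cK := continuous_scaleKer (h := h) hK.continuous
  have cK' := continuous_scaleKer (h := h') hK'.continuous
  have cQ := continuous_scaleKer (h := 𝓱) hQ.continuous
  have cQ' := continuous_scaleKer (h := 𝓱') hQ'.continuous
  have sK' := abs_scaleKer_le hh' hK'
  have sQ := abs_scaleKer_le h𝓱 hQ
  have iK' := lintegral_scaleKer_le hh' hk hK'
  have iQ := lintegral_scaleKer_le h𝓱 hk hQ
  have sK := abs_scaleKer_sub_le hL hk hK' hδ hKK hh hh' h1 h2
  have iK := lintegral_scaleKer_sub_le hL hk hK hK' hδ hKK hh hh' h1 h2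
  have sQQ := abs_scaleKer_sub_le hL hk hQ' hδ hQQ h𝓱 h𝓱' h3 h4
  have iQQ := lintegral_scaleKer_sub_le hL hk hQ hQ' hδ hQQ h𝓱 h𝓱' h3 h4
  have hpt : ∀ x, ‖convol (scaleKer K h) (scaleKer Q 𝓱) x
        - convol (scaleKer K' h') (scaleKer Q' 𝓱') x‖ₑ
      ≤ (∫⁻ y, ‖scaleKer K h (x - y) - scaleKer K' h' (x - y)‖ₑ * ‖scaleKer Q 𝓱 y‖ₑ)
        + ∫⁻ y, ‖scaleKer K' h' (x - y)‖ₑ * ‖scaleKer Q 𝓱 y - scaleKer Q' 𝓱' y‖ₑ := fun x =>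
    enorm_convol_sub_le cK cQ cK'
      (integrable_convol_integrand cK cQ (by positivity) (abs_scaleKer_le hh hK) iQ x)
      (integrable_convol_integrand cK' cQ' (by positivity) sK'
        (lintegral_scaleKer_le h𝓱' hk hQ') x)
  refine eLpNorm_le_of_lintegral_le_of_bound (by positivity) (lt_max_of_lt_left hW1) hc ?_ ?_ hp
  · refine (lintegral_mono hpt).trans ?_
    have m1 : Measurable fun x => ∫⁻ y,
        ‖scaleKer K h (x - y) - scaleKer K' h' (x - y)‖ₑ * ‖scaleKer Q 𝓱 y‖ₑ :=
      Measurable.lintegral_prod_right (by fun_prop)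
    rw [lintegral_add_left m1,
      lintegral_lintegral_enorm_mul (f := fun x => scaleKer K h x - scaleKer K' h' x)
        (cK.sub cK') cQ,
      lintegral_lintegral_enorm_mul (g := fun x => scaleKer Q 𝓱 x - scaleKer Q' 𝓱' x)
        cK' (cQ.sub cQ')]
    calc _ ≤ ENNReal.ofReal (Dfun d L kinf δ) * ENNReal.ofReal kinf
          + ENNReal.ofReal kinf * ENNReal.ofReal (Dfun d L kinf δ) := by gcongr
      _ = ENNReal.ofReal (2 * kinf * Dfun d L kinf δ) := by
          rw [← ENNReal.ofReal_mul hD, ← ENNReal.ofReal_mul hk,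
            ← ENNReal.ofReal_add (by positivity) (by positivity)]
          congr 1
          ring
      _ ≤ _ := ENNReal.ofReal_le_ofReal (by gcongr)
  · intro x
    have key : ∀ {A B : ℝ}, 0 ≤ A → 0 ≤ B →
        (∫⁻ y, ‖scaleKer K h (x - y) - scaleKer K' h' (x - y)‖ₑ * ‖scaleKer Q 𝓱 y‖ₑ)
          ≤ ENNReal.ofReal A →
        (∫⁻ y, ‖scaleKer K' h' (x - y)‖ₑ * ‖scaleKer Q 𝓱 y - scaleKer Q' 𝓱' y‖ₑ)
          ≤ ENNReal.ofReal B →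
        |convol (scaleKer K h) (scaleKer Q 𝓱) x
          - convol (scaleKer K' h') (scaleKer Q' 𝓱') x| ≤ A + B := by
      intro A B hA hB hA' hB'
      rw [← ENNReal.ofReal_le_ofReal_iff (by positivity), ENNReal.ofReal_add hA hB,
        ← Real.norm_eq_abs, ofReal_norm]
      exact (hpt x).trans (add_le_add hA' hB')
    rcases le_total (Vh fun i => max (𝓱 i) (𝓱' i)) (Vh fun i => max (h i) (h' i)) with hle | hle
    · rw [max_eq_left hle]
      refine (key (by positivity) (by positivity)
        (lintegral_enorm_mul_le_left (f := fun z => scaleKer K h z - scaleKer K' h' z)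
          (by positivity) sK iQ)
        (lintegral_enorm_mul_le_left (g := fun z => scaleKer Q 𝓱 z - scaleKer Q' 𝓱' z)
          (by positivity) sK' iQQ)).trans ?_
      have e1 := inv_Vh_mul_Dfun_le hL.le hk hδ hV1' hW1 (Vh_max_le_right hδ hh' h1)
      have e2 := mul_le_mul_of_nonneg_right hDD (inv_pos.2 hW1).le
      linarith [mul_le_mul_of_nonneg_left (add_le_add e1 e2) hk]
    · rw [max_eq_right hle]
      refine (key (by positivity) (by positivity)
        (lintegral_enorm_mul_le_right (f := fun z => scaleKer K h z - scaleKer K' h' z)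
          (by positivity) iK sQ)
        (lintegral_enorm_mul_le_right (g := fun z => scaleKer Q 𝓱 z - scaleKer Q' 𝓱' z)
          (by positivity) iK' sQQ)).trans ?_
      have e1 := inv_Vh_mul_Dfun_le hL.le hk hδ hV2 hW2 (Vh_max_le_left hδ h𝓱 h4)
      have e2 := mul_le_mul_of_nonneg_right hDD (inv_pos.2 hW2).le
      linarith [mul_le_mul_of_nonneg_left (add_le_add e1 e2) hk]

end ScaledConvolution

/-- **Lemma: `L_p`-bounds for rescaled kernels and their convolutions.** -/
theorem statement18 (d : ℕ) (hd : 0 < d) (n : ℕ) (hn : 1 ≤ n)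
    (L k1 kinf : ℝ) (hk1 : 0 < k1) (hk1' : k1 ≤ 1) (hkinf : 1 ≤ kinf) (hL : 0 < L)
    (K K' Q Q' : (Fin d → ℝ) → ℝ)
    (hK : AssumpK L k1 kinf K) (hK' : AssumpK L k1 kinf K')
    (hQ : AssumpK L k1 kinf Q) (hQ' : AssumpK L k1 kinf Q')
    (h h' 𝓱 𝓱' : Fin d → ℝ)
    (hh : ∀ i, h i ∈ Set.Ioc (0 : ℝ) 1) (hh' : ∀ i, h' i ∈ Set.Ioc (0 : ℝ) 1)
    (h𝓱 : ∀ i, 𝓱 i ∈ Set.Ioc (0 : ℝ) 1) (h𝓱' : ∀ i, 𝓱' i ∈ Set.Ioc (0 : ℝ) 1)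
    (p : ℝ≥0∞) (hp : 1 ≤ p) :
    -- (1): exact L_p-norm of n⁻¹ K_h
    (eLpNorm (fun x => (n : ℝ)⁻¹ * scaleKer K h x) p volume
      = ENNReal.ofReal ((n : ℝ)⁻¹ * Vh h ^ (-1 + (1 / p).toReal)) * eLpNorm K p volume) ∧
    -- (2): L_p-distance between n⁻¹ K_h and n⁻¹ K'_{h'}
    (eLpNorm (fun x => (n : ℝ)⁻¹ * scaleKer K h x - (n : ℝ)⁻¹ * scaleKer K' h' x) p volume
      ≤ ENNReal.ofReal ((n : ℝ)⁻¹ * Vh (fun i => max (h i) (h' i)) ^ (-1 + (1 / p).toReal) *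
          Dfun d L kinf (max (supDist K K') (DeltaH h h')))) ∧
    -- (3): L_p-distance between the convolutions n⁻¹(K_h * Q_𝔥) and n⁻¹(K'_{h'} * Q'_{𝔥'})
    (eLpNorm (fun x => (n : ℝ)⁻¹ * convol (scaleKer K h) (scaleKer Q 𝓱) x -
        (n : ℝ)⁻¹ * convol (scaleKer K' h') (scaleKer Q' 𝓱') x) p volume
      ≤ ENNReal.ofReal (2 * (n : ℝ)⁻¹ * kinf *
          (max (Vh fun i => max (h i) (h' i)) (Vh fun i => max (𝓱 i) (𝓱' i)))
              ^ (-1 + (1 / p).toReal) *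
          Dfun d L kinf (2 * max (max (supDist K K') (supDist Q Q'))
            (max (DeltaH h h') (DeltaH 𝓱 𝓱'))))) := by
  have ph : ∀ i, 0 < h i := fun i => (hh i).1
  have ph' : ∀ i, 0 < h' i := fun i => (hh' i).1
  have p𝓱 : ∀ i, 0 < 𝓱 i := fun i => (h𝓱 i).1
  have p𝓱' : ∀ i, 0 < 𝓱' i := fun i => (h𝓱' i).1
  have hk : 0 ≤ kinf := by linarith
  have hn0 : 0 ≤ (n : ℝ)⁻¹ := by positivity
  refine ⟨eLpNorm_scaleKer ph hK.continuous hn0 p, ?_, ?_⟩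
  · set δ := max (supDist K K') (DeltaH h h')
    have hδ : 0 ≤ δ := le_max_of_le_left supDist_nonneg
    have hKK : ∀ x, |K x - K' x| ≤ δ := fun x =>
      (abs_sub_le_supDist hK hK' x).trans (le_max_left _ _)
    obtain ⟨h1, h2⟩ := le_exp_mul_of_DeltaH_le ph ph' (le_max_right _ _ : DeltaH h h' ≤ δ)
    simp only [← mul_sub]
    exact eLpNorm_le_of_lintegral_le_of_bound (Dfun_nonneg hL.le hk hδ)
      (Vh_pos fun i => lt_max_of_lt_left (ph i)) hn0
      (lintegral_scaleKer_sub_le hL hk hK hK' hδ hKK ph ph' h1 h2)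
      (abs_scaleKer_sub_le hL hk hK' hδ hKK ph ph' h1 h2) hp
  · set δ := max (max (supDist K K') (supDist Q Q')) (max (DeltaH h h') (DeltaH 𝓱 𝓱'))
    have hδ : 0 ≤ δ := le_max_of_le_left (le_max_of_le_left supDist_nonneg)
    have hKK : ∀ x, |K x - K' x| ≤ δ := fun x =>
      (abs_sub_le_supDist hK hK' x).trans ((le_max_left _ _).trans (le_max_left _ _))
    have hQQ : ∀ x, |Q x - Q' x| ≤ δ := fun x =>
      (abs_sub_le_supDist hQ hQ' x).trans ((le_max_right _ _).trans (le_max_left _ _))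
    obtain ⟨h1, h2⟩ := le_exp_mul_of_DeltaH_le ph ph'
      ((le_max_left _ _).trans (le_max_right _ _) : DeltaH h h' ≤ δ)
    obtain ⟨h3, h4⟩ := le_exp_mul_of_DeltaH_le p𝓱 p𝓱'
      ((le_max_right _ _).trans (le_max_right _ _) : DeltaH 𝓱 𝓱' ≤ δ)
    simp only [← mul_sub]
    refine (eLpNorm_convol_scaleKer_sub_le hL hk hK hK' hQ hQ' hδ hKK hQQ ph ph' p𝓱 p𝓱'
      h1 h2 h3 h4 hn0 hp).trans (le_of_eq ?_)
    congr 1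
    ring
end
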